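/- The two quantum dilogarithm factorizations of the flipped quasi R-matrix coincide, as an identity in A⟦t⟧: the ordered product obtained from ∏_{k=1}^{n} ∏_{j=1}^{θ(k)} ∏_{i=−j}^{j−1} ψ_1(w_j^i ⊗ m_{θ(j)}^{k−θ(j)−1}) · ∏_{k=1}^{n} ∏_{j=θ(k)}^{n} ∏_{i=−θ(j)}^{θ(j)−1} ψ_1(w_{θ(j)}^{i} ⊗ m_j^{j−θ(k)}) by applying to every dilogarithm argument the flip x ⊗ y ↦ y ⊗ x (keeping the order of the factors) is equal to ∏_{k=0}^{n−1} ∏_{j=θ(k)}^{n+1} ∏_{i=1}^{θ(k+1)} ψ_1(m_{j−i}^{i−θ(k)} ⊗ w_{i+θ(j)}^{−i}) · ∏_{k=0}^{n−1} ∏_{j=θ(k)}^{n+1} ∏_{i=1}^{θ(k+1)} ψ_1(m_{j−i}^{i−θ(k)} ⊗ w_{i+θ(j)}^{θ(j)}) · ∏_{k=1}^{n} ∏_{j=k+1}^{n+1} ∏_{i=1}^{k} ψ_1(m_{i+θ(j)}^{i−1} ⊗ w_{j−i}^{k−j}) · ∏_{k=1}^{n} ∏_{j=k+1}^{n+1}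 ∏_{i=1}^{k} ψ_1(m_{i+θ(j)}^{i−1} ⊗ w_{j−i}^{k−i}), where θ is extended by θ(0) = n+1 and θ(n+1) = 0, and all multiple products are expanded from left to right with indices in ascending order (first k, then j, then i). Moreover, any two dilogarithm arguments that occur in opposite relative order in the two products commute with each other. -/

import Mathlib

noncomputable section

/-- The ground field `𝕂 = ℂ(q)`, the field of rational functions over `ℂ`. -/
abbrev Kq : Type := RatFunc ℂ

/-- The formal variable `q ∈ ℂ(q)`. -/
def qq : Kq := RatFunc.X

/-- `𝐢 = √−1 ∈ ℂ`, viewed as a constant in `𝕂 = ℂ(q)`. -/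
def ii : Kq := RatFunc.C Complex.I

/-- `θ(i) = n + 1 − i`. -/
def th (n : ℕ) (i : ℤ) : ℤ := (n : ℤ) + 1 - i

/-- Labels for the vertices of the `𝒟ₙ`-quiver: `V i r` stands for `V_{i,r}`
(the canonical labels), and `C i` stands for the central vertex `Λ_{i,0}`. -/
inductive DnLabel : Type
  | V : ℤ → ℤ → DnLabel
  | C : ℤ → DnLabel
deriving DecidableEq

/-- Validity of a label for given rank `n`: `V i r` requires `1 ≤ i ≤ n`, `−i ≤ r ≤ i`;
`C i` requires `1 ≤ i ≤ n`.  There are `n² + 3n` valid labels. -/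
def DnLabel.valid (n : ℕ) : DnLabel → Prop
  | .V i r => 1 ≤ i ∧ i ≤ (n : ℤ) ∧ -i ≤ r ∧ r ≤ i
  | .C i => 1 ≤ i ∧ i ≤ (n : ℤ)

instance (n : ℕ) (v : DnLabel) : Decidable (v.valid n) := by
  cases v <;> unfold DnLabel.valid <;> infer_instance

/-- The vertex set of the `𝒟ₙ`-quiver. -/
def DnVertex (n : ℕ) := {v : DnLabel // v.valid n}

/-- The canonical label of the vertex `Λ_{i,r}`, using the identifications
`Λ_{a,b} = V_{θ(b),−θ(a)}` for `b > 0` and `Λ_{a,b} = V_{θ(−b),θ(a)}` for `b < 0`. -/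
def Lam (n : ℕ) (i r : ℤ) : DnLabel :=
  if 0 < r then .V (th n r) (-(th n i))
  else if r < 0 then .V (th n (-r)) (th n i)
  else .C i

/-- The list of arrows `(source, target, doubled weight)` of the `𝒟ₙ`-quiver, obtained by
amalgamating two copies of the Fock–Goncharov `(n+1)`-triangle quiver along two pairs of
sides.  Solid (weight `1`) arrows get doubled weight `2`, dashed (weight `1/2`) arrows get
doubled weight `1`.  The families are: the horizontal `V_i`- and `Λ_i`-path arrows, the
dashed boundary arrows along the two frozen columns, and, for each `1 ≤ i < n`, the
oriented cycle `V_{i,0} → V_{i+1,−1} → ⋯ → V_{n,i−n} → Λ_{i,0} → V_{n,n−i} → ⋯ → V_{i+1,1} → V_{i,0}`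
through the central column. -/
def dnArrows (n : ℕ) : List (DnLabel × DnLabel × ℤ) :=
  ((List.range n).flatMap fun i0 =>
    (List.range (2 * i0 + 2)).map fun k =>
      (DnLabel.V ((i0 : ℤ) + 1) (-((i0 : ℤ) + 1) + k),
       DnLabel.V ((i0 : ℤ) + 1) (-((i0 : ℤ) + 1) + k + 1), 2))
  ++ ((List.range n).flatMap fun i0 =>
    (List.range (2 * i0 + 2)).map fun k =>
      (Lam n ((i0 : ℤ) + 1) (-((i0 : ℤ) + 1) + k),
       Lam n ((i0 : ℤ) + 1) (-((i0 : ℤ) + 1) + k + 1), 2))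
  ++ ((List.range (n - 1)).map fun i0 =>
      (DnLabel.V ((i0 : ℤ) + 1) (-((i0 : ℤ) + 1)),
       DnLabel.V ((i0 : ℤ) + 2) (-((i0 : ℤ) + 2)), 1))
  ++ ((List.range (n - 1)).map fun i0 =>
      (DnLabel.V ((i0 : ℤ) + 2) ((i0 : ℤ) + 2),
       DnLabel.V ((i0 : ℤ) + 1) ((i0 : ℤ) + 1), 1))
  ++ ((List.range (n - 1)).flatMap fun i0 =>
      (((List.range (n - 1 - i0)).map fun k =>
          (DnLabel.V ((i0 : ℤ) + 1 + k) (-(k : ℤ)),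
           DnLabel.V ((i0 : ℤ) + 2 + k) (-(k : ℤ) - 1), 2))
        ++ [(DnLabel.V (n : ℤ) ((i0 : ℤ) + 1 - n), DnLabel.C ((i0 : ℤ) + 1), 2),
            (DnLabel.C ((i0 : ℤ) + 1), DnLabel.V (n : ℤ) ((n : ℤ) - (i0 + 1)), 2)]
        ++ ((List.range (n - 1 - i0)).map fun k =>
          (DnLabel.V ((i0 : ℤ) + 2 + k) ((k : ℤ) + 1),
           DnLabel.V ((i0 : ℤ) + 1 + k) (k : ℤ), 2))))

/-- The doubled exchange matrix `2·ε_{uv}` of the `𝒟ₙ`-quiver. -/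
def eps2 (n : ℕ) (u v : DnLabel) : ℤ :=
  ((dnArrows n).map fun a =>
    (if a.1 = u ∧ a.2.1 = v then a.2.2 else 0)
      - (if a.1 = v ∧ a.2.1 = u then a.2.2 else 0)).sum

/-- The defining relations of the quantum torus algebra `𝒟ₙ`: generators `X_v^{±1}`
(`Sum.inl v` is `X_v`, `Sum.inr v` is `X_v⁻¹`) with `X_u X_v = q^{2 ε_{vu}} X_v X_u`. -/
inductive DnRel (n : ℕ) :
    FreeAlgebra Kq (DnVertex n ⊕ DnVertex n) →
      FreeAlgebra Kq (DnVertex n ⊕ DnVertex n) → Prop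
  | comm (u v : DnVertex n) :
      DnRel n (FreeAlgebra.ι Kq (Sum.inl u) * FreeAlgebra.ι Kq (Sum.inl v))
        ((qq ^ eps2 n v.1 u.1) • (FreeAlgebra.ι Kq (Sum.inl v) * FreeAlgebra.ι Kq (Sum.inl u)))
  | mul_inv (v : DnVertex n) :
      DnRel n (FreeAlgebra.ι Kq (Sum.inl v) * FreeAlgebra.ι Kq (Sum.inr v)) 1
  | inv_mul (v : DnVertex n) :
      DnRel n (FreeAlgebra.ι Kq (Sum.inr v) * FreeAlgebra.ι Kq (Sum.inl v)) 1

/-- The quantum torus algebra `𝒟ₙ`. -/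
abbrev Dtorus (n : ℕ) := RingQuot (DnRel n)

/-- The cluster variable `X_v ∈ 𝒟ₙ` attached to a label (junk value `1` on invalid labels). -/
def Xg (n : ℕ) (v : DnLabel) : Dtorus n :=
  if h : v.valid n then RingQuot.mkAlgHom Kq (DnRel n) (FreeAlgebra.ι Kq (Sum.inl ⟨v, h⟩)) else 1

/-- The inverse cluster variable `X_v⁻¹ ∈ 𝒟ₙ` (junk value `1` on invalid labels). -/
def Xinv (n : ℕ) (v : DnLabel) : Dtorus n :=
  if h : v.valid n then RingQuot.mkAlgHom Kq (DnRel n) (FreeAlgebra.ι Kq (Sum.inr ⟨v, h⟩)) else 1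

/-- The ordered product `X_{V_{i,−i}} X_{V_{i,1−i}} ⋯ X_{V_{i,r}}`. -/
def Vprod (n : ℕ) (i r : ℤ) : Dtorus n :=
  ((List.range (r + i + 1).toNat).map fun k => Xg n (.V i (-i + k))).prod

/-- The ordered product `X_{Λ_{i,−i}} X_{Λ_{i,1−i}} ⋯ X_{Λ_{i,r}}`. -/
def Lprod (n : ℕ) (i r : ℤ) : Dtorus n :=
  ((List.range (r + i + 1).toNat).map fun k => Xg n (Lam n i (-i + k))).prod

/-- `w_i^r = 𝐢 q^{i+r} X_{V_{i,−i}} X_{V_{i,1−i}} ⋯ X_{V_{i,r}}`. -/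
def ww (n : ℕ) (i r : ℤ) : Dtorus n := (ii * qq ^ (i + r)) • Vprod n i r

/-- `m_i^r = 𝐢 q^{i+r} X_{Λ_{i,−i}} X_{Λ_{i,1−i}} ⋯ X_{Λ_{i,r}}`. -/
def mm (n : ℕ) (i r : ℤ) : Dtorus n := (ii * qq ^ (i + r)) • Lprod n i r


open scoped TensorProduct

/-- `A = 𝒟ₙ ⊗_𝕂 𝒟ₙ`. -/
abbrev AA (n : ℕ) := Dtorus n ⊗[Kq] Dtorus n

/-- `∏_{j=1}^{m} (q^{2j} − 1)`. -/
def qfac (m : ℕ) : Kq := ∏ j ∈ Finset.range m, (qq ^ (2 * (j + 1)) - 1)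

/-- The quantum dilogarithm `ψ_h(x) = Ψ^q(−t^h x) ∈ B⟦t⟧`, i.e. the t-adically convergent
infinite product `∏_{k=0}^{∞} (1 − q^{2k+1} t^h x)^{−1}`; explicitly it is the
`q`-exponential series `Σ_{m≥0} (−1)^m q^m x^m t^{hm} / ∏_{j=1}^{m}(q^{2j} − 1)`,
the unique solution with constant term `1` of `Ψ^q(q²z) = (1+qz)Ψ^q(z)` at `z = −t^h x`. -/
def psiH {B : Type*} [Ring B] [Algebra Kq B] (h : ℕ) (x : B) : PowerSeries B :=
  PowerSeries.mk fun d =>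
    if 0 < h ∧ h ∣ d then
      (((-1 : Kq) ^ (d / h) * qq ^ (d / h) / qfac (d / h)) • x ^ (d / h))
    else 0

/-- The sequence of dilogarithm arguments of the factorization of the flipped quasi
`R`-matrix obtained from Schrader–Shapiro Theorem 8.4 by applying the flip
`x ⊗ y ↦ y ⊗ x` to every argument (keeping the order of the factors):
first `∏_{k=1}^{n} ∏_{j=1}^{θ(k)} ∏_{i=−j}^{j−1}` of `m_{θ(j)}^{k−θ(j)−1} ⊗ w_j^i`,
then `∏_{k=1}^{n} ∏_{j=θ(k)}^{n} ∏_{i=−θ(j)}^{θ(j)−1}` of `m_j^{j−θ(k)} ⊗ w_{θ(j)}^i`,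
all indices ascending. -/
def argsA (n : ℕ) : List (AA n) :=
  ((List.range n).flatMap fun k0 =>
    (List.range (n - k0)).flatMap fun j0 =>
      (List.range (2 * j0 + 2)).map fun i0 =>
        (mm n (th n ((j0 : ℤ) + 1)) (((k0 : ℤ) + 1) - th n ((j0 : ℤ) + 1) - 1)) ⊗ₜ[Kq]
          (ww n ((j0 : ℤ) + 1) (-((j0 : ℤ) + 1) + i0)))
  ++ ((List.range n).flatMap fun k0 =>
    (List.range (k0 + 1)).flatMap fun j1 =>
      (List.range (2 * (k0 + 1 - j1))).map fun i0 =>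
        (mm n ((n : ℤ) - k0 + j1) (((n : ℤ) - k0 + j1) - th n ((k0 : ℤ) + 1))) ⊗ₜ[Kq]
          (ww n (th n ((n : ℤ) - k0 + j1)) (-(th n ((n : ℤ) - k0 + j1)) + i0)))

/-- The sequence of dilogarithm arguments of the factorization of the flipped quasi
`R`-matrix arising from the sequence of `4·C(n+2,3)` cluster mutations realizing the
half-Dehn twist of the twice punctured disk:
`∏_{k=0}^{n−1} ∏_{j=θ(k)}^{n+1} ∏_{i=1}^{θ(k+1)}` of `m_{j−i}^{i−θ(k)} ⊗ w_{i+θ(j)}^{−i}`,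
then of `m_{j−i}^{i−θ(k)} ⊗ w_{i+θ(j)}^{θ(j)}`, then
`∏_{k=1}^{n} ∏_{j=k+1}^{n+1} ∏_{i=1}^{k}` of `m_{i+θ(j)}^{i−1} ⊗ w_{j−i}^{k−j}`, then of
`m_{i+θ(j)}^{i−1} ⊗ w_{j−i}^{k−i}`; all indices ascending (here `θ(0) = n+1`, `θ(n+1) = 0`). -/
def argsB (n : ℕ) : List (AA n) :=
  ((List.range n).flatMap fun k0 =>
    (List.range (k0 + 1)).flatMap fun j1 =>
      (List.range (n - k0)).map fun i0 =>
        (mm n (((n : ℤ) + 1 - k0 + j1) - ((i0 : ℤ) + 1)) (((i0 : ℤ) + 1) - th n (k0 : ℤ)))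
          ⊗ₜ[Kq] (ww n (((i0 : ℤ) + 1) + th n ((n : ℤ) + 1 - k0 + j1)) (-((i0 : ℤ) + 1))))
  ++ ((List.range n).flatMap fun k0 =>
    (List.range (k0 + 1)).flatMap fun j1 =>
      (List.range (n - k0)).map fun i0 =>
        (mm n (((n : ℤ) + 1 - k0 + j1) - ((i0 : ℤ) + 1)) (((i0 : ℤ) + 1) - th n (k0 : ℤ)))
          ⊗ₜ[Kq] (ww n (((i0 : ℤ) + 1) + th n ((n : ℤ) + 1 - k0 + j1))
            (th n ((n : ℤ) + 1 - k0 + j1))))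
  ++ ((List.range n).flatMap fun k0 =>
    (List.range (n - k0)).flatMap fun j1 =>
      (List.range (k0 + 1)).map fun i0 =>
        (mm n (((i0 : ℤ) + 1) + th n ((k0 : ℤ) + 2 + j1)) ((i0 : ℤ)))
          ⊗ₜ[Kq] (ww n (((k0 : ℤ) + 2 + j1) - ((i0 : ℤ) + 1))
            (((k0 : ℤ) + 1) - ((k0 : ℤ) + 2 + j1))))
  ++ ((List.range n).flatMap fun k0 =>
    (List.range (n - k0)).flatMap fun j1 =>
      (List.range (k0 + 1)).map fun i0 =>
        (mm n (((i0 : ℤ) + 1) + th n ((k0 : ℤ) + 2 + j1)) ((i0 : ℤ)))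
          ⊗ₜ[Kq] (ww n (((k0 : ℤ) + 2 + j1) - ((i0 : ℤ) + 1))
            (((k0 : ℤ) + 1) - ((i0 : ℤ) + 1))))

/-- The total doubled weight of the arrows `u → v` in a list of arrows. -/
def arrowWeight (L : List (DnLabel × DnLabel × ℤ)) (u v : DnLabel) : ℤ :=
  (L.map fun a => if a.1 = u ∧ a.2.1 = v then a.2.2 else 0).sum

theorem arrowWeight_append (L M : List (DnLabel × DnLabel × ℤ)) (u v : DnLabel) :
    arrowWeight (L ++ M) u v = arrowWeight L u v + arrowWeight M u v := by
  simp [arrowWeight]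

theorem arrowWeight_flatMap {α : Type*} (l : List α) (f : α → List (DnLabel × DnLabel × ℤ))
    (u v : DnLabel) :
    arrowWeight (l.flatMap f) u v = (l.map fun i => arrowWeight (f i) u v).sum := by
  induction l with
  | nil => simp [arrowWeight]
  | cons x l ih => simp [arrowWeight_append, ih]

theorem arrowWeight_flatMap_append {α : Type*} (l : List α)
    (f g : α → List (DnLabel × DnLabel × ℤ)) (u v : DnLabel) :
    arrowWeight (l.flatMap fun i => f i ++ g i) u v =
      arrowWeight (l.flatMap f) u v + arrowWeight (l.flatMap g) u v := by
  simp [arrowWeight_flatMap, arrowWeight_append, List.sum_map_add]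

theorem eps2_eq (n : ℕ) (u v : DnLabel) :
    eps2 n u v = arrowWeight (dnArrows n) u v - arrowWeight (dnArrows n) v u := by
  unfold eps2 arrowWeight
  induction dnArrows n with
  | nil => simp
  | cons x l ih =>
    simp only [List.map_cons, List.sum_cons, ih]
    ring

theorem sum_map_range_eq {n : ℕ} {g : ℕ → ℤ} (i₀ : ℕ) (h : ∀ i < n, i ≠ i₀ → g i = 0) :
    ((List.range n).map g).sum = if i₀ < n then g i₀ else 0 := by
  induction n with
  | zero => simp
  | succ n ih =>
    rw [List.sum_range_succ, ih fun i hi => h i (by omega)]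
    rcases lt_trichotomy i₀ n with h' | rfl | h'
    · rw [if_pos h', if_pos (by omega), h n (by omega) (by omega), add_zero]
    · simp
    · rw [if_neg (by omega), if_neg (by omega), h n (by omega) (by omega), add_zero]

/-- In a family of arrows indexed by a range, at most one of which is `u → v`, the total weight
of the arrows `u → v` is an indicator. -/
theorem arrowWeight_map_range {n : ℕ} {s t : ℕ → DnLabel} {w : ℤ} {u v : DnLabel}
    {Q : Prop} [Decidable Q] (i₀ : ℕ)
    (huniq : ∀ i < n, s i = u → t i = v → i = i₀) (hQ : Q ↔ i₀ < n ∧ s i₀ = u ∧ t i₀ = v) :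
    arrowWeight ((List.range n).map fun i => (s i, t i, w)) u v = if Q then w else 0 := by
  unfold arrowWeight
  rw [List.map_map, sum_map_range_eq i₀]
  · simp only [Function.comp, ← ite_and, hQ]
  · intro i hi hne
    exact if_neg fun h => hne (huniq i hi h.1 h.2)

theorem arrowWeight_flatMap_range {n : ℕ} {m : ℕ → ℕ} {s t : ℕ → ℕ → DnLabel} {w : ℤ}
    {u v : DnLabel} {Q : Prop} [Decidable Q] (i₀ k₀ : ℕ)
    (huniq : ∀ i < n, ∀ k < m i, s i k = u → t i k = v → i = i₀ ∧ k = k₀)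
    (hQ : Q ↔ i₀ < n ∧ k₀ < m i₀ ∧ s i₀ k₀ = u ∧ t i₀ k₀ = v) :
    arrowWeight ((List.range n).flatMap fun i =>
      (List.range (m i)).map fun k => (s i k, t i k, w)) u v = if Q then w else 0 := by
  rw [arrowWeight_flatMap, sum_map_range_eq i₀]
  · by_cases hi : i₀ < n
    · rw [if_pos hi]
      exact arrowWeight_map_range k₀ (fun k hk hs ht => (huniq i₀ hi k hk hs ht).2)
        (by simp [hQ, hi])
    · rw [if_neg hi, if_neg (by tauto)]
  · intro i hi hne
    rw [arrowWeight_map_range (Q := False) k₀]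
    · simp
    · exact fun k hk hs ht => (huniq i hi k hk hs ht).2
    · simpa using fun hk hs ht => hne (huniq i hi k₀ hk hs ht).1

theorem Lam_eq_V_iff (n : ℕ) (i r a k : ℤ) :
    Lam n i r = .V a k ↔
      0 < r ∧ a = n + 1 - r ∧ k = i - n - 1 ∨ r < 0 ∧ a = n + 1 + r ∧ k = n + 1 - i := by
  unfold Lam th
  split_ifs <;> simp <;> omega

theorem Lam_eq_C_iff (n : ℕ) (i r c : ℤ) : Lam n i r = .C c ↔ r = 0 ∧ c = i := by
  unfold Lam
  split_ifs <;> simp <;> omega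

/-- The doubled weight of the arrow from `V_{a,k}` to `V_{b,l}`. -/
def arrowV (a k b l : ℤ) : ℤ :=
  if b = a ∧ l = k + 1 then 2
  else if l = k ∧ (k < 0 ∧ b = a - 1 ∨ 0 < k ∧ b = a + 1) then 2
  else if l = k - 1 ∧ (k ≤ 0 ∧ b = a + 1 ∨ 0 < k ∧ b = a - 1) then
    if k = a ∨ k = -a then 1 else 2
  else 0

theorem map_coe_list {β : Type*} (L : List ℕ) (f : ℤ → β) :
    List.map f (do let a ← L; pure (a : ℤ)) = L.map fun k : ℕ => f k := by
  induction L with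
  | nil => rfl
  | cons x L ih => simpa using ih

theorem arrowWeight_dnArrows (n : ℕ) (u v : DnLabel) :
    arrowWeight (dnArrows n) u v =
      arrowWeight ((List.range n).flatMap fun i : ℕ =>
        (List.range (2 * i + 2)).map fun k : ℕ =>
          (DnLabel.V ((i : ℤ) + 1) (-((i : ℤ) + 1) + (k : ℤ)),
           DnLabel.V ((i : ℤ) + 1) (-((i : ℤ) + 1) + (k : ℤ) + 1), 2)) u v +
      arrowWeight ((List.range n).flatMap fun i : ℕ =>
        (List.range (2 * i + 2)).map fun k : ℕ =>
          (Lam n ((i : ℤ) + 1) (-((i : ℤ) + 1) + (k : ℤ)),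
           Lam n ((i : ℤ) + 1) (-((i : ℤ) + 1) + (k : ℤ) + 1), 2)) u v +
      arrowWeight ((List.range (n - 1)).map fun i : ℕ =>
          (DnLabel.V ((i : ℤ) + 1) (-((i : ℤ) + 1)),
           DnLabel.V ((i : ℤ) + 2) (-((i : ℤ) + 2)), 1)) u v +
      arrowWeight ((List.range (n - 1)).map fun i : ℕ =>
          (DnLabel.V ((i : ℤ) + 2) ((i : ℤ) + 2),
           DnLabel.V ((i : ℤ) + 1) ((i : ℤ) + 1), 1)) u v +
      (arrowWeight ((List.range (n - 1)).flatMap fun i : ℕ =>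
          (List.range (n - 1 - i)).map fun k : ℕ =>
            (DnLabel.V ((i : ℤ) + 1 + k) (-(k : ℤ)),
             DnLabel.V ((i : ℤ) + 2 + k) (-(k : ℤ) - 1), 2)) u v +
        (arrowWeight ((List.range (n - 1)).map fun i : ℕ =>
            (DnLabel.V (n : ℤ) ((i : ℤ) + 1 - n), DnLabel.C ((i : ℤ) + 1), 2)) u v +
          arrowWeight ((List.range (n - 1)).map fun i : ℕ =>
            (DnLabel.C ((i : ℤ) + 1), DnLabel.V (n : ℤ) ((n : ℤ) - ((i : ℤ) + 1)), 2)) u v) +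
        arrowWeight ((List.range (n - 1)).flatMap fun i : ℕ =>
          (List.range (n - 1 - i)).map fun k : ℕ =>
            (DnLabel.V ((i : ℤ) + 2 + k) ((k : ℤ) + 1),
             DnLabel.V ((i : ℤ) + 1 + k) (k : ℤ), 2)) u v) := by
  have h : ∀ (N : ℕ) (f g : ℕ → DnLabel × DnLabel × ℤ),
      arrowWeight ((List.range N).flatMap fun i => [f i, g i]) u v =
        arrowWeight ((List.range N).map f) u v + arrowWeight ((List.range N).map g) u v := by
    intro N f g
    rw [arrowWeight_flatMap]
    simp [arrowWeight, Function.comp_def, List.sum_map_add]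
  simp only [dnArrows, arrowWeight_append, arrowWeight_flatMap_append, h, map_coe_list]

theorem arrowWeight_V_V {n : ℕ} {a k b l : ℤ} (hu : (DnLabel.V a k).valid n)
    (hv : (DnLabel.V b l).valid n) :
    arrowWeight (dnArrows n) (.V a k) (.V b l) = arrowV a k b l := by
  obtain ⟨ha, han, hk, hk'⟩ := hu
  obtain ⟨hb, hbn, hl, hl'⟩ := hv
  rw [arrowWeight_dnArrows,
    arrowWeight_flatMap_range (Q := b = a ∧ l = k + 1) (a - 1).toNat (k + a).toNat,
    arrowWeight_flatMap_range
      (Q := l = k ∧ (k < 0 ∧ b = a - 1 ∨ 0 < k ∧ b = a + 1))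
      (if k < 0 then (n + k).toNat else (n - k).toNat)
      (if k < 0 then (n + 1 - a + (n + 1 + k)).toNat else (a - n - 1 + (n + 1 - k)).toNat),
    arrowWeight_map_range (Q := k = -a ∧ l = k - 1 ∧ b = a + 1) (a - 1).toNat,
    arrowWeight_map_range (Q := k = a ∧ l = k - 1 ∧ b = a - 1) (a - 2).toNat,
    arrowWeight_flatMap_range (Q := k ≤ 0 ∧ k ≠ -a ∧ l = k - 1 ∧ b = a + 1)
      (a + k - 1).toNat (-k).toNat,
    arrowWeight_map_range (Q := False) 0,
    arrowWeight_map_range (Q := False) 0,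
    arrowWeight_flatMap_range (Q := 0 < k ∧ k ≠ a ∧ l = k - 1 ∧ b = a - 1)
      (a - k - 1).toNat (k - 1).toNat]
  · simp only [if_false, arrowV]
    split_ifs <;> omega
  all_goals
    simp only [DnLabel.V.injEq, reduceCtorEq, Lam_eq_V_iff, false_and, and_false,
      IsEmpty.forall_iff, implies_true]
  all_goals first | done | omega | split_ifs <;> omega

theorem arrowWeight_V_C {n : ℕ} {a k c : ℤ} (hu : (DnLabel.V a k).valid n)
    (hv : (DnLabel.C c).valid n) :
    arrowWeight (dnArrows n) (.V a k) (.C c) =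
      if a = n ∧ (k = n + 1 - c ∨ k = c - n ∧ c < n) then 2 else 0 := by
  obtain ⟨ha, han, hk, hk'⟩ := hu
  obtain ⟨hc, hcn⟩ := hv
  rw [arrowWeight_dnArrows,
    arrowWeight_flatMap_range (Q := False) 0 0,
    arrowWeight_flatMap_range (Q := a = n ∧ k = n + 1 - c) (c - 1).toNat (c - 1).toNat,
    arrowWeight_map_range (Q := False) 0,
    arrowWeight_map_range (Q := False) 0,
    arrowWeight_flatMap_range (Q := False) 0 0,
    arrowWeight_map_range (Q := a = n ∧ k = c - n ∧ c < n) (c - 1).toNat,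
    arrowWeight_map_range (Q := False) 0,
    arrowWeight_flatMap_range (Q := False) 0 0]
  · simp only [if_false]
    split_ifs <;> omega
  all_goals
    simp only [DnLabel.V.injEq, DnLabel.C.injEq, reduceCtorEq, Lam_eq_V_iff, Lam_eq_C_iff,
      and_false, IsEmpty.forall_iff, implies_true]
  all_goals omega

theorem arrowWeight_C_V {n : ℕ} {b l c : ℤ} (hu : (DnLabel.C c).valid n)
    (hv : (DnLabel.V b l).valid n) :
    arrowWeight (dnArrows n) (.C c) (.V b l) =
      if b = n ∧ (l = c - n - 1 ∨ l = n - c ∧ c < n) then 2 else 0 := by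
  obtain ⟨hb, hbn, hl, hl'⟩ := hv
  obtain ⟨hc, hcn⟩ := hu
  rw [arrowWeight_dnArrows,
    arrowWeight_flatMap_range (Q := False) 0 0,
    arrowWeight_flatMap_range (Q := b = n ∧ l = c - n - 1) (c - 1).toNat c.toNat,
    arrowWeight_map_range (Q := False) 0,
    arrowWeight_map_range (Q := False) 0,
    arrowWeight_flatMap_range (Q := False) 0 0,
    arrowWeight_map_range (Q := False) 0,
    arrowWeight_map_range (Q := b = n ∧ l = n - c ∧ c < n) (c - 1).toNat,
    arrowWeight_flatMap_range (Q := False) 0 0]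
  · simp only [if_false]
    split_ifs <;> omega
  all_goals
    simp only [DnLabel.V.injEq, DnLabel.C.injEq, reduceCtorEq, Lam_eq_V_iff, Lam_eq_C_iff,
      false_and, and_false, IsEmpty.forall_iff, implies_true]
  all_goals omega

theorem arrowWeight_C_C (n : ℕ) (c d : ℤ) :
    arrowWeight (dnArrows n) (.C c) (.C d) = 0 := by
  rw [arrowWeight_dnArrows,
    arrowWeight_flatMap_range (Q := False) 0 0,
    arrowWeight_flatMap_range (Q := False) 0 0,
    arrowWeight_map_range (Q := False) 0,
    arrowWeight_map_range (Q := False) 0,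
    arrowWeight_flatMap_range (Q := False) 0 0,
    arrowWeight_map_range (Q := False) 0,
    arrowWeight_map_range (Q := False) 0,
    arrowWeight_flatMap_range (Q := False) 0 0]
  · simp
  all_goals
    simp only [reduceCtorEq, Lam_eq_C_iff, false_and, and_false, IsEmpty.forall_iff,
      implies_true]
  · rintro i - k - ⟨h, -⟩ ⟨h', -⟩
    omega
  · simp

theorem Lam_valid {n : ℕ} {a k : ℤ} (h : (DnLabel.V a k).valid n) : (Lam n a k).valid n := by
  obtain ⟨ha, han, hk, hk'⟩ := h
  unfold Lam th
  split_ifs <;> simp only [DnLabel.valid] <;> omega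

/-- The `180°` rotation of the quiver preserves the arrows between the vertices `V_{i,r}`. -/
theorem arrowWeight_Lam_Lam {n : ℕ} {a k b l : ℤ} (hu : (DnLabel.V a k).valid n)
    (hv : (DnLabel.V b l).valid n) :
    arrowWeight (dnArrows n) (Lam n a k) (Lam n b l) = arrowV a k b l := by
  have hu' := Lam_valid hu
  have hv' := Lam_valid hv
  obtain ⟨ha, han, hk, hk'⟩ := hu
  obtain ⟨hb, hbn, hl, hl'⟩ := hv
  unfold Lam th at *
  split_ifs at hu' hv' ⊢
  all_goals first
    | rw [arrowWeight_V_V hu' hv']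
    | rw [arrowWeight_V_C hu' hv']
    | rw [arrowWeight_C_V hu' hv']
    | rw [arrowWeight_C_C]
  all_goals
    simp only [arrowV]
    split_ifs <;> omega

theorem qq_ne_zero : qq ≠ 0 := RatFunc.X_ne_zero

section QCommute

variable {B C : Type*} [Ring B] [Algebra Kq B] [Ring C] [Algebra Kq C]

/-- `x` and `y` commute up to the factor `q ^ e`. -/
def QCommute (e : ℤ) (x y : B) : Prop := x * y = qq ^ e • (y * x)

theorem QCommute.one_left (y : B) : QCommute 0 1 y := by
  simp [QCommute]

theorem QCommute.one_right (x : B) : QCommute 0 x 1 := by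
  simp [QCommute]

theorem QCommute.mul_left {d e : ℤ} {x y z : B} (hx : QCommute d x z) (hy : QCommute e y z) :
    QCommute (d + e) (x * y) z := by
  unfold QCommute at *
  rw [mul_assoc, hy, mul_smul_comm, ← mul_assoc, hx, smul_mul_assoc, smul_smul,
    ← zpow_add₀ qq_ne_zero, add_comm, mul_assoc]

theorem QCommute.mul_right {d e : ℤ} {x y z : B} (hy : QCommute d x y) (hz : QCommute e x z) :
    QCommute (d + e) x (y * z) := by
  unfold QCommute at *
  rw [← mul_assoc, hy, smul_mul_assoc, mul_assoc, hz, mul_smul_comm, smul_smul,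
    ← zpow_add₀ qq_ne_zero, mul_assoc]

theorem QCommute.symm {e : ℤ} {x y : B} (h : QCommute e x y) : QCommute (-e) y x := by
  unfold QCommute at *
  rw [h, smul_smul, ← zpow_add₀ qq_ne_zero, neg_add_cancel, zpow_zero, one_smul]

theorem QCommute.smul_smul {e : ℤ} {x y : B} (h : QCommute e x y) (c d : Kq) :
    QCommute e (c • x) (d • y) := by
  unfold QCommute at *
  rw [smul_mul_smul_comm, smul_mul_smul_comm, h, smul_comm, mul_comm c d]

theorem QCommute.commute_tmul {d e : ℤ} {x y : B} {x' y' : C} (h : QCommute d x y)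
    (h' : QCommute e x' y') (hde : d + e = 0) :
    Commute (x ⊗ₜ[Kq] x') (y ⊗ₜ[Kq] y') := by
  unfold QCommute at *
  rw [commute_iff_eq, Algebra.TensorProduct.tmul_mul_tmul, h, h', TensorProduct.smul_tmul_smul,
    ← zpow_add₀ qq_ne_zero, hde, zpow_zero, one_smul, Algebra.TensorProduct.tmul_mul_tmul]

end QCommute

theorem qCommute_Xg {n : ℕ} {u v : DnLabel} (hu : u.valid n) (hv : v.valid n) :
    QCommute (eps2 n v u) (Xg n u) (Xg n v) := by
  unfold QCommute Xg
  rw [dif_pos hu, dif_pos hv, ← map_mul, ← map_mul, ← map_smul]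
  exact RingQuot.mkAlgHom_rel Kq (DnRel.comm ⟨u, hu⟩ ⟨v, hv⟩)

/-- A labelling `f` of vertices by pairs of integers for which the arrows between the `f i r` are
those between the vertices `V_{i,r}`. -/
def IsRowLabelling (n : ℕ) (f : ℤ → ℤ → DnLabel) : Prop :=
  ∀ a k, (DnLabel.V a k).valid n → (f a k).valid n ∧ ∀ b l, (DnLabel.V b l).valid n →
    eps2 n (f a k) (f b l) = arrowV a k b l - arrowV b l a k

theorem isRowLabelling_V (n : ℕ) : IsRowLabelling n .V := fun _ _ h =>
  ⟨h, fun _ _ h' => by rw [eps2_eq, arrowWeight_V_V h h', arrowWeight_V_V h' h]⟩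

theorem isRowLabelling_Lam (n : ℕ) : IsRowLabelling n (Lam n) := fun _ _ h =>
  ⟨Lam_valid h, fun _ _ h' => by rw [eps2_eq, arrowWeight_Lam_Lam h h', arrowWeight_Lam_Lam h' h]⟩

/-- The product of the first `m` cluster variables in the `i`-th row of a labelling. -/
def rowProd (n : ℕ) (f : ℤ → ℤ → DnLabel) (i : ℤ) (m : ℕ) : Dtorus n :=
  ((List.range m).map fun k : ℕ => Xg n (f i (-i + k))).prod

theorem rowProd_zero (n : ℕ) (f : ℤ → ℤ → DnLabel) (i : ℤ) : rowProd n f i 0 = 1 := rfl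

theorem rowProd_succ (n : ℕ) (f : ℤ → ℤ → DnLabel) (i : ℤ) (m : ℕ) :
    rowProd n f i (m + 1) = rowProd n f i m * Xg n (f i (-i + m)) :=
  List.prod_range_succ _ _

theorem Vprod_eq_rowProd (n : ℕ) (i r : ℤ) :
    Vprod n i r = rowProd n .V i (r + i + 1).toNat := by
  simp only [Vprod, rowProd, map_coe_list]

theorem Lprod_eq_rowProd (n : ℕ) (i r : ℤ) :
    Lprod n i r = rowProd n (Lam n) i (r + i + 1).toNat := by
  simp only [Lprod, rowProd, map_coe_list]

/-- The pairing of the vertices `V_{a,−a}, …, V_{a,r}` with `V_{b,l}`, for `b = a` and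
`b > a`. -/
def rowVertexExp (a r b l : ℤ) : ℤ :=
  if b = a then
    if l = -a then if -a < r then -2 else 0
    else if l = r ∨ l = r + 1 then 2 else 0
  else if b = a + 1 then
    if l = -b then if -a ≤ r then 1 else 0
    else if l = r + 1 ∧ 0 < l ∨ l = r ∧ l < 0 then -2 else 0
  else 0

/-- The pairing of the vertices `V_{a,−a}, …, V_{a,r}` with `V_{b,−b}, …, V_{b,s}`. -/
def rowExp (a r b s : ℤ) : ℤ :=
  if b = a then if r < s then 2 else if s < r then -2 else 0
  else if b = a + 1 then if s < r ∨ s = r ∧ 0 ≤ r then 1 else -1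
  else if a = b + 1 then if r < s ∨ r = s ∧ 0 ≤ s then -1 else 1
  else 0

theorem rowExp_swap (a r b s : ℤ) : rowExp b s a r = -rowExp a r b s := by
  unfold rowExp
  split_ifs <;> omega

theorem arrowV_self (a k l : ℤ) : arrowV a k a l = if l = k + 1 then 2 else 0 := by
  unfold arrowV
  split_ifs <;> omega

theorem arrowV_succ {a : ℤ} (ha : 1 ≤ a) (k l : ℤ) :
    arrowV a k (a + 1) l =
      if l = k ∧ 0 < k then 2
      else if l = k - 1 ∧ k ≤ 0 then if k = -a then 1 else 2
      else 0 := by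
  unfold arrowV
  split_ifs <;> omega

theorem arrowV_pred {a : ℤ} (ha : 1 ≤ a) (k l : ℤ) :
    arrowV (a + 1) k a l =
      if l = k ∧ k < 0 then 2
      else if l = k - 1 ∧ 0 < k then if k = a + 1 then 1 else 2
      else 0 := by
  unfold arrowV
  split_ifs <;> omega

theorem arrowV_eq_zero {a b : ℤ} (h : b ≠ a) (h₁ : b ≠ a + 1) (h₂ : b ≠ a - 1) (k l : ℤ) :
    arrowV a k b l = 0 := by
  unfold arrowV
  split_ifs <;> omega

theorem qCommute_Xg_rowProd {n : ℕ} {f : ℤ → ℤ → DnLabel} (hf : IsRowLabelling n f)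
    {a b l : ℤ} (ha : 1 ≤ a) (hab : a ≤ b) (hv : (DnLabel.V b l).valid n) (m : ℕ)
    (hm : m ≤ 2 * a) :
    QCommute (rowVertexExp a (m - 1 - a) b l) (Xg n (f b l)) (rowProd n f a m) := by
  obtain ⟨hb, hbn, hl, hl'⟩ := hv
  induction m with
  | zero =>
    rw [rowProd_zero]
    convert QCommute.one_right _ using 1
    unfold rowVertexExp
    split_ifs <;> omega
  | succ m ih =>
    have hu : (DnLabel.V a (-a + m)).valid n := ⟨ha, by omega, by omega, by omega⟩
    have hv : (DnLabel.V b l).valid n := ⟨hb, hbn, hl, hl'⟩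
    rw [rowProd_succ]
    convert (ih (by omega)).mul_right (qCommute_Xg (hf b l hv).1 (hf a _ hu).1) using 1
    rw [(hf a _ hu).2 b l hv]
    clear ih
    rcases eq_or_ne b a with rfl | h
    · rw [arrowV_self, arrowV_self]
      simp only [rowVertexExp, if_true]
      split_ifs <;> omega
    rcases eq_or_ne b (a + 1) with rfl | h'
    · rw [arrowV_succ ha, arrowV_pred ha]
      simp only [rowVertexExp, if_true, if_neg h]
      split_ifs <;> omega
    · rw [arrowV_eq_zero (by omega) (by omega) (by omega),
        arrowV_eq_zero (by omega) (by omega) (by omega)]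
      simp only [rowVertexExp, if_neg h, if_neg h', sub_self, add_zero]

theorem qCommute_rowProd_of_le {n : ℕ} {f : ℤ → ℤ → DnLabel} (hf : IsRowLabelling n f)
    {a b : ℤ} (ha : 1 ≤ a) (hab : a ≤ b) (hbn : b ≤ n) (m m' : ℕ) (hm : m + 1 ≤ 2 * a)
    (hm' : m' + 1 ≤ 2 * b) :
    QCommute (rowExp a (m - a) b (m' - b)) (rowProd n f b (m' + 1)) (rowProd n f a (m + 1)) := by
  have key (l : ℤ) (hl : -b ≤ l) (hl' : l ≤ b) :
      QCommute (rowVertexExp a (m - a) b l) (Xg n (f b l)) (rowProd n f a (m + 1)) := by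
    convert qCommute_Xg_rowProd hf ha hab (l := l) ⟨by omega, hbn, hl, hl'⟩ (m + 1)
      (by omega) using 2
    omega
  induction m' with
  | zero =>
    rw [rowProd_succ, rowProd_zero, one_mul]
    convert key (-b + (0 : ℕ)) (by omega) (by omega) using 1
    unfold rowExp rowVertexExp
    split_ifs <;> omega
  | succ m' ih =>
    rw [rowProd_succ]
    convert (ih (by omega)).mul_left (key (-b + (m' + 1 : ℕ)) (by omega) (by omega)) using 1
    clear ih key
    unfold rowExp rowVertexExp
    split_ifs <;> omega

theorem qCommute_rowProd {n : ℕ} {f : ℤ → ℤ → DnLabel} (hf : IsRowLabelling n f)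
    {a r b s : ℤ} (ha : 1 ≤ a) (han : a ≤ n) (hr : -a ≤ r) (hr' : r < a)
    (hb : 1 ≤ b) (hbn : b ≤ n) (hs : -b ≤ s) (hs' : s < b) :
    QCommute (rowExp a r b s) (rowProd n f b (s + b + 1).toNat)
      (rowProd n f a (r + a + 1).toNat) := by
  obtain ⟨m, hm⟩ := Int.eq_ofNat_of_zero_le (show 0 ≤ r + a by omega)
  obtain ⟨m', hm'⟩ := Int.eq_ofNat_of_zero_le (show 0 ≤ s + b by omega)
  obtain rfl : r = m - a := by omega
  obtain rfl : s = m' - b := by omega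
  rw [show ((m : ℤ) - a + a + 1).toNat = m + 1 by omega,
    show ((m' : ℤ) - b + b + 1).toNat = m' + 1 by omega]
  rcases le_total a b with hab | hab
  · exact qCommute_rowProd_of_le hf ha hab hbn m m' (by omega) (by omega)
  · rw [rowExp_swap]
    exact (qCommute_rowProd_of_le hf hb hab han m' m (by omega) (by omega)).symm

theorem qq_zpow_injective : Function.Injective fun d : ℤ => qq ^ d := by
  have hdeg (k : ℕ) : (qq ^ k).intDegree = k := by
    induction k with
    | zero => simp
    | succ k ih =>
      rw [pow_succ, RatFunc.intDegree_mul (pow_ne_zero _ qq_ne_zero) qq_ne_zero, ih, qq,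
        RatFunc.intDegree_X, Nat.cast_succ]
  have key (d e : ℤ) (hde : d ≤ e) (h : qq ^ d = qq ^ e) : d = e := by
    obtain ⟨k, rfl⟩ := Int.le.dest hde
    rw [zpow_add₀ qq_ne_zero, left_eq_mul₀ (zpow_ne_zero _ qq_ne_zero), zpow_natCast] at h
    have := hdeg k
    rw [h, RatFunc.intDegree_one] at this
    omega
  intro d e h
  rcases le_total d e with hde | hde
  · exact key d e hde h
  · exact (key e d hde h.symm).symm

theorem Xg_mul_Xinv {n : ℕ} {v : DnLabel} (hv : v.valid n) : Xg n v * Xinv n v = 1 := by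
  rw [Xg, Xinv, dif_pos hv, dif_pos hv, ← map_mul, ← map_one (RingQuot.mkAlgHom Kq (DnRel n))]
  exact RingQuot.mkAlgHom_rel Kq (DnRel.mul_inv ⟨v, hv⟩)

theorem Xinv_mul_Xg {n : ℕ} {v : DnLabel} (hv : v.valid n) : Xinv n v * Xg n v = 1 := by
  rw [Xg, Xinv, dif_pos hv, dif_pos hv, ← map_mul, ← map_one (RingQuot.mkAlgHom Kq (DnRel n))]
  exact RingQuot.mkAlgHom_rel Kq (DnRel.inv_mul ⟨v, hv⟩)

theorem isUnit_Xg {n : ℕ} {v : DnLabel} (hv : v.valid n) : IsUnit (Xg n v) :=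
  ⟨⟨_, _, Xg_mul_Xinv hv, Xinv_mul_Xg hv⟩, rfl⟩

/-- The endomorphism `X_v ↦ q^{f(v)} X_v` of the quantum torus algebra. -/
def scaleHom (n : ℕ) (f : DnLabel → ℤ) : Dtorus n →ₐ[Kq] Dtorus n :=
  RingQuot.liftAlgHom Kq ⟨FreeAlgebra.lift Kq (Sum.elim (fun v => qq ^ f v.1 • Xg n v.1)
    fun v => qq ^ (-f v.1) • Xinv n v.1), by
      intro x y h
      induction h with
      | comm u v =>
        have := (qCommute_Xg u.2 v.2).smul_smul (qq ^ f u.1) (qq ^ f v.1)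
        simpa [QCommute] using this
      | mul_inv v =>
        simp [smul_smul, ← zpow_add₀ qq_ne_zero, Xg_mul_Xinv v.2, -zpow_neg]
      | inv_mul v =>
        simp [smul_smul, ← zpow_add₀ qq_ne_zero, Xinv_mul_Xg v.2, -zpow_neg]⟩

theorem scaleHom_Xg {n : ℕ} (f : DnLabel → ℤ) {v : DnLabel} (hv : v.valid n) :
    scaleHom n f (Xg n v) = qq ^ f v • Xg n v := by
  conv_lhs => rw [Xg, dif_pos hv]
  rw [scaleHom, RingQuot.liftAlgHom_mkAlgHom_apply, FreeAlgebra.lift_ι_apply]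
  rfl

theorem isUnit_rowProd {n : ℕ} {g : ℤ → ℤ → DnLabel} (hg : IsRowLabelling n g) {i : ℤ}
    (hi : 1 ≤ i) (hin : i ≤ n) (m : ℕ) (hm : m ≤ 2 * i) : IsUnit (rowProd n g i m) := by
  induction m with
  | zero => exact isUnit_one
  | succ m ih =>
    rw [rowProd_succ]
    exact (ih (by omega)).mul (isUnit_Xg (hg _ _ ⟨hi, hin, by omega, by omega⟩).1)

theorem scaleHom_rowProd {n : ℕ} {g : ℤ → ℤ → DnLabel} (hg : IsRowLabelling n g)
    {f : DnLabel → ℤ} {c i : ℤ} (hi : 1 ≤ i) (hin : i ≤ n)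
    (hf : ∀ k, (DnLabel.V i k).valid n → f (g i k) = c) (m : ℕ) (hm : m ≤ 2 * i) :
    scaleHom n f (rowProd n g i m) = qq ^ (c * m) • rowProd n g i m := by
  induction m with
  | zero => simp [rowProd_zero]
  | succ m ih =>
    have hv : (DnLabel.V i (-i + m)).valid n := ⟨hi, hin, by omega, by omega⟩
    rw [rowProd_succ, map_mul, ih (by omega), scaleHom_Xg f (hg _ _ hv).1, hf _ hv,
      smul_mul_smul_comm, ← zpow_add₀ qq_ne_zero, Nat.cast_succ, mul_add, mul_one]

/-- The indicator function of the vertices `V_{a,r}`. -/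
def rowIndicator (a : ℤ) : DnLabel → ℤ
  | .V i _ => if i = a then 1 else 0
  | .C _ => 0

/-- The `180°` rotation of the quiver. -/
def rotate (n : ℕ) : DnLabel → DnLabel
  | .V i r => Lam n i r
  | .C i => .V i 0

theorem rotate_Lam {n : ℕ} {i k : ℤ} (h : (DnLabel.V i k).valid n) :
    rotate n (Lam n i k) = .V i k := by
  obtain ⟨hi, hin, hk, hk'⟩ := h
  rw [Lam]
  split_ifs
  · simp only [rotate, Lam_eq_V_iff, th]
    omega
  · simp only [rotate, Lam_eq_V_iff, th]
    omega
  · simp only [rotate, DnLabel.V.injEq, true_and]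
    omega

theorem ii_ne_zero : ii ≠ 0 := by simp [ii]

theorem scale_ne_zero (e : ℤ) : ii * qq ^ e ≠ 0 :=
  mul_ne_zero ii_ne_zero (zpow_ne_zero _ qq_ne_zero)

theorem IsUnit.kq_smul {B : Type*} [Ring B] [Algebra Kq B] {c : Kq} (hc : c ≠ 0) {x : B}
    (hx : IsUnit x) : IsUnit (c • x) := by
  rw [Algebra.smul_def]
  exact ((IsUnit.mk0 c hc).map _).mul hx

section Monomials

variable {n : ℕ} {i r : ℤ}

theorem isUnit_ww (hi : 1 ≤ i) (hin : i ≤ n) (hr' : r < i) : IsUnit (ww n i r) := by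
  rw [ww, Vprod_eq_rowProd]
  exact (isUnit_rowProd (isRowLabelling_V n) hi hin _ (by omega)).kq_smul (scale_ne_zero _)

theorem isUnit_mm (hi : 1 ≤ i) (hin : i ≤ n) (hr' : r < i) : IsUnit (mm n i r) := by
  rw [mm, Lprod_eq_rowProd]
  exact (isUnit_rowProd (isRowLabelling_Lam n) hi hin _ (by omega)).kq_smul (scale_ne_zero _)

theorem scaleHom_ww (a : ℤ) (hi : 1 ≤ i) (hin : i ≤ n) (hr : -i ≤ r) (hr' : r < i) :
    scaleHom n (rowIndicator a) (ww n i r) =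
      qq ^ (if i = a then r + i + 1 else 0) • ww n i r := by
  rw [ww, Vprod_eq_rowProd, map_smul, scaleHom_rowProd (c := if i = a then 1 else 0)
    (isRowLabelling_V n) hi hin (fun k _ => rfl) _ (by omega), smul_comm,
    Int.toNat_of_nonneg (by omega), ite_mul, one_mul, zero_mul]

theorem scaleHom_mm (a : ℤ) (hi : 1 ≤ i) (hin : i ≤ n) (hr : -i ≤ r) (hr' : r < i) :
    scaleHom n (rowIndicator a ∘ rotate n) (mm n i r) =
      qq ^ (if i = a then r + i + 1 else 0) • mm n i r := by
  rw [mm, Lprod_eq_rowProd, map_smul, scaleHom_rowProd (c := if i = a then 1 else 0)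
    (isRowLabelling_Lam n) hi hin (fun k hk => by rw [Function.comp, rotate_Lam hk]; rfl) _
    (by omega), smul_comm, Int.toNat_of_nonneg (by omega), ite_mul, one_mul, zero_mul]

end Monomials

theorem qCommute_ww {n : ℕ} {a r b s : ℤ} (ha : 1 ≤ a) (han : a ≤ n) (hr : -a ≤ r) (hr' : r < a)
    (hb : 1 ≤ b) (hbn : b ≤ n) (hs : -b ≤ s) (hs' : s < b) :
    QCommute (rowExp a r b s) (ww n b s) (ww n a r) := by
  rw [ww, ww, Vprod_eq_rowProd, Vprod_eq_rowProd]
  exact (qCommute_rowProd (isRowLabelling_V n) ha han hr hr' hb hbn hs hs').smul_smul _ _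

theorem qCommute_mm {n : ℕ} {a r b s : ℤ} (ha : 1 ≤ a) (han : a ≤ n) (hr : -a ≤ r) (hr' : r < a)
    (hb : 1 ≤ b) (hbn : b ≤ n) (hs : -b ≤ s) (hs' : s < b) :
    QCommute (rowExp a r b s) (mm n b s) (mm n a r) := by
  rw [mm, mm, Lprod_eq_rowProd, Lprod_eq_rowProd]
  exact (qCommute_rowProd (isRowLabelling_Lam n) ha han hr hr' hb hbn hs hs').smul_smul _ _

/-- Two units of a nontrivial algebra that are `q`-power eigenvectors of a linear map can only
agree if the eigenvalues do. -/
theorem eq_of_map_eq_qq_zpow_smul {B : Type*} [Ring B] [Nontrivial B] [Algebra Kq B]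
    (F : B →ₐ[Kq] B) {x y : B} {d e : ℤ} (hx : F x = qq ^ d • x) (hy : F y = qq ^ e • y)
    (hu : IsUnit x) (hxy : x = y) : d = e := by
  subst hxy
  exact qq_zpow_injective (smul_left_injective Kq hu.ne_zero (hx.symm.trans hy))

/-- The index `(a, r, b, s)` of a dilogarithm argument `m_a^r ⊗ w_b^s` lies in the admissible
range. -/
structure IsAdmissible (n : ℕ) (t : ℤ × ℤ × ℤ × ℤ) : Prop where
  left_pos : 1 ≤ t.1
  right_pos : 1 ≤ t.2.2.1
  add_eq : t.1 + t.2.2.1 = n + 1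
  neg_le_left : -t.1 ≤ t.2.1
  left_lt : t.2.1 < t.1
  neg_le_right : -t.2.2.1 ≤ t.2.2.2
  right_lt : t.2.2.2 < t.2.2.1

/-- The dilogarithm argument `m_a^r ⊗ w_b^s`. -/
def dilogArg (n : ℕ) (t : ℤ × ℤ × ℤ × ℤ) : AA n := mm n t.1 t.2.1 ⊗ₜ[Kq] ww n t.2.2.1 t.2.2.2

theorem IsAdmissible.isUnit_dilogArg {n : ℕ} {t : ℤ × ℤ × ℤ × ℤ} (h : IsAdmissible n t) :
    IsUnit (dilogArg n t) := by
  obtain ⟨h1, h2, h3, h4, h5, h6, h7⟩ := h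
  have hm := (isUnit_mm (n := n) h1 (by omega) h5).map
    (Algebra.TensorProduct.includeLeft : Dtorus n →ₐ[Kq] AA n)
  have hw := (isUnit_ww (n := n) h2 (by omega) h7).map
    (Algebra.TensorProduct.includeRight : Dtorus n →ₐ[Kq] AA n)
  simpa [dilogArg] using hm.mul hw

theorem dilogArg_injective {n : ℕ} [Nontrivial (AA n)] {t t' : ℤ × ℤ × ℤ × ℤ}
    (h : IsAdmissible n t) (h' : IsAdmissible n t') (heq : dilogArg n t = dilogArg n t') :
    t = t' := by
  have hu := h.isUnit_dilogArg
  obtain ⟨a, r, b, s⟩ := t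
  obtain ⟨a', r', b', s'⟩ := t'
  obtain ⟨h1, h2, h3, h4, h5, h6, h7⟩ := h
  obtain ⟨h1', h2', h3', h4', h5', h6', h7'⟩ := h'
  dsimp only at *
  have hleft := eq_of_map_eq_qq_zpow_smul
    (Algebra.TensorProduct.map (scaleHom n (rowIndicator a ∘ rotate n)) (AlgHom.id Kq (Dtorus n)))
    (x := dilogArg n (a, r, b, s)) (y := dilogArg n (a', r', b', s'))
    (by rw [dilogArg, Algebra.TensorProduct.map_tmul, scaleHom_mm a h1 (by omega) h4 h5]; rfl)
    (by rw [dilogArg, Algebra.TensorProduct.map_tmul, scaleHom_mm a h1' (by omega) h4' h5']; rfl)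
    hu heq
  have hright := eq_of_map_eq_qq_zpow_smul
    (Algebra.TensorProduct.map (AlgHom.id Kq (Dtorus n)) (scaleHom n (rowIndicator b)))
    (x := dilogArg n (a, r, b, s)) (y := dilogArg n (a', r', b', s'))
    (by rw [dilogArg, Algebra.TensorProduct.map_tmul, scaleHom_ww b h2 (by omega) h6 h7,
      TensorProduct.tmul_smul]; rfl)
    (by rw [dilogArg, Algebra.TensorProduct.map_tmul, scaleHom_ww b h2' (by omega) h6' h7',
      TensorProduct.tmul_smul]; rfl)
    hu heq
  simp only [Prod.mk.injEq]
  split_ifs at hleft hright <;> omega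

theorem commute_dilogArg {n : ℕ} {a r b s a' r' b' s' : ℤ} (h : IsAdmissible n (a, r, b, s))
    (h' : IsAdmissible n (a', r', b', s')) (he : rowExp a r a' r' + rowExp b s b' s' = 0) :
    Commute (dilogArg n (a, r, b, s)) (dilogArg n (a', r', b', s')) := by
  obtain ⟨h1, h2, h3, h4, h5, h6, h7⟩ := h
  obtain ⟨h1', h2', h3', h4', h5', h6', h7'⟩ := h'
  exact ((qCommute_mm h1 (by omega) h4 h5 h1' (by omega) h4' h5').commute_tmul
    (qCommute_ww h2 (by omega) h6 h7 h2' (by omega) h6' h7') he).symm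

section Lists

variable {α : Type*}

/-- The list of the `f k j i` with `k < n`, `j < m k` and `i < p k j`, in lexicographic order. -/
def lexList (n : ℕ) (m : ℕ → ℕ) (p : ℕ → ℕ → ℕ) (f : ℕ → ℕ → ℕ → α) : List α :=
  (List.range n).flatMap fun k => (List.range (m k)).flatMap fun j =>
    (List.range (p k j)).map (f k j)

variable {n : ℕ} {m : ℕ → ℕ} {p : ℕ → ℕ → ℕ} {f : ℕ → ℕ → ℕ → α}

theorem mem_lexList {x : α} :
    x ∈ lexList n m p f ↔ ∃ k < n, ∃ j < m k, ∃ i < p k j, f k j i = x := by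
  simp [lexList]

theorem pairwise_range_of_lt {R : ℕ → ℕ → Prop} (h : ∀ i j, i < j → j < n → R i j) :
    (List.range n).Pairwise R :=
  List.pairwise_lt_range.imp_of_mem fun _ hj hij => h _ _ hij (List.mem_range.1 hj)

theorem pairwise_lexList {R : α → α → Prop}
    (h₁ : ∀ k k' j j' i i', k < k' → k' < n → j < m k → j' < m k' → i < p k j → i' < p k' j' →
      R (f k j i) (f k' j' i'))
    (h₂ : ∀ k j j' i i', k < n → j < j' → j' < m k → i < p k j → i' < p k j' →
      R (f k j i) (f k j' i'))
    (h₃ : ∀ k j i i', k < n → j < m k → i < i' → i' < p k j → R (f k j i) (f k j i')) :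
    (lexList n m p f).Pairwise R := by
  refine List.pairwise_flatMap.2 ⟨fun k hk => List.pairwise_flatMap.2 ⟨fun j hj =>
    List.pairwise_map.2 (pairwise_range_of_lt fun i i' hi hi' => ?_),
    pairwise_range_of_lt fun j j' hj hj' => ?_⟩, pairwise_range_of_lt fun k k' hk hk' => ?_⟩
  · exact h₃ k j i i' (List.mem_range.1 hk) (List.mem_range.1 hj) hi hi'
  · simp only [List.mem_map, List.mem_range]
    rintro _ ⟨i, hi, rfl⟩ _ ⟨i', hi', rfl⟩
    exact h₂ k j j' i i' (List.mem_range.1 hk) hj hj' hi hi'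
  · simp only [List.mem_flatMap, List.mem_map, List.mem_range]
    rintro _ ⟨j, hj, i, hi, rfl⟩ _ ⟨j', hj', i', hi', rfl⟩
    exact h₁ k k' j j' i i' hk hk' hj hj' hi hi'

/-- Two orderings of the same factors have the same product if any two factors that occur in
opposite relative order commute. -/
theorem prod_map_eq_of_perm {M : Type*} [Monoid M] {R S : α → α → Prop} (g : α → M) :
    ∀ {l₁ l₂ : List α}, l₁.Perm l₂ → l₁.Pairwise R → l₂.Pairwise S →
      (∀ x ∈ l₁, ∀ y ∈ l₁, R x y → S y x → Commute (g x) (g y)) →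
      (l₁.map g).prod = (l₂.map g).prod := by
  intro l₁
  induction l₁ with
  | nil =>
    intro l₂ hp _ _ _
    rw [hp.nil_eq]
  | cons x l ih =>
    intro l₂ hp hR hS hc
    obtain ⟨s, t, rfl⟩ := List.append_of_mem (hp.subset List.mem_cons_self)
    have hp' : l.Perm (s ++ t) := List.Perm.cons_inv (hp.trans List.perm_middle)
    rw [List.pairwise_cons] at hR
    have hS' : (s ++ t).Pairwise S :=
      hS.sublist (List.Sublist.append_left (List.sublist_cons_self x t) s)
    have hcomm : Commute (g x) (s.map g).prod := by
      refine Commute.list_prod_right _ _ fun z hz => ?_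
      obtain ⟨y, hy, rfl⟩ := List.mem_map.1 hz
      have hyl : y ∈ l := hp'.symm.subset (List.mem_append_left t hy)
      exact hc x List.mem_cons_self y (List.mem_cons_of_mem x hyl) (hR.1 y hyl)
        ((List.pairwise_append.1 hS).2.2 y hy x List.mem_cons_self)
    rw [List.map_cons, List.prod_cons, ih hp' hR.2 hS' fun a ha b hb =>
      hc a (List.mem_cons_of_mem x ha) b (List.mem_cons_of_mem x hb)]
    simp only [List.map_append, List.map_cons, List.prod_append, List.prod_cons]
    rw [← mul_assoc, hcomm.eq, mul_assoc]

end Lists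

theorem commute_psiH {B : Type*} [Ring B] [Algebra Kq B] {h : ℕ} {x y : B} (hxy : Commute x y) :
    Commute (psiH h x) (psiH h y) := by
  have hcoeff (d e : ℕ) :
      Commute (PowerSeries.coeff d (psiH h x)) (PowerSeries.coeff e (psiH h y)) := by
    simp only [psiH, PowerSeries.coeff_mk]
    split_ifs
    · exact ((hxy.pow_pow _ _).smul_left _).smul_right _
    all_goals simp
  rw [commute_iff_eq]
  ext d
  rw [PowerSeries.coeff_mul, PowerSeries.coeff_mul, ← Finset.Nat.sum_antidiagonal_swap]
  exact Finset.sum_congr rfl fun e _ => (hcoeff _ _).eq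

/-- The order of the indices `(a, r, b, s)` in the first factorization. -/
def OrderA (t t' : ℤ × ℤ × ℤ × ℤ) : Prop :=
  t.2.1 < 0 ∧ 0 ≤ t'.2.1 ∨
  t.2.1 < 0 ∧ t'.2.1 < 0 ∧
    (t.2.1 + t.1 < t'.2.1 + t'.1 ∨
      t.2.1 + t.1 = t'.2.1 + t'.1 ∧ (t.2.2.1 < t'.2.2.1 ∨
        t.2.2.1 = t'.2.2.1 ∧ t.2.2.2 < t'.2.2.2)) ∨
  0 ≤ t.2.1 ∧ 0 ≤ t'.2.1 ∧
    (t.2.1 - t.1 < t'.2.1 - t'.1 ∨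
      t.2.1 - t.1 = t'.2.1 - t'.1 ∧ (t.1 < t'.1 ∨ t.1 = t'.1 ∧ t.2.2.2 < t'.2.2.2))

/-- The order of the indices `(a, r, b, s)` in the second factorization. -/
def OrderB (t t' : ℤ × ℤ × ℤ × ℤ) : Prop :=
  t.2.1 < 0 ∧ 0 ≤ t'.2.1 ∨
  (t.2.1 < 0 ↔ t'.2.1 < 0) ∧ t.2.2.2 < 0 ∧ 0 ≤ t'.2.2.2 ∨
  t.2.1 < 0 ∧ t'.2.1 < 0 ∧ t.2.2.2 < 0 ∧ t'.2.2.2 < 0 ∧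
    (t.2.1 + t.2.2.2 < t'.2.1 + t'.2.2.2 ∨
      t.2.1 + t.2.2.2 = t'.2.1 + t'.2.2.2 ∧ (t.1 - t.2.2.2 < t'.1 - t'.2.2.2 ∨
        t.1 - t.2.2.2 = t'.1 - t'.2.2.2 ∧ t'.2.2.2 < t.2.2.2)) ∨
  t.2.1 < 0 ∧ t'.2.1 < 0 ∧ 0 ≤ t.2.2.2 ∧ 0 ≤ t'.2.2.2 ∧
    (t.1 + t.2.1 + t.2.2.2 < t'.1 + t'.2.1 + t'.2.2.2 ∨
      t.1 + t.2.1 + t.2.2.2 = t'.1 + t'.2.1 + t'.2.2.2 ∧ (t'.2.2.2 < t.2.2.2 ∨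
        t.2.2.2 = t'.2.2.2 ∧ t.2.2.1 < t'.2.2.1)) ∨
  0 ≤ t.2.1 ∧ 0 ≤ t'.2.1 ∧ t.2.2.2 < 0 ∧ t'.2.2.2 < 0 ∧
    (t.2.2.1 + t.2.1 + t.2.2.2 < t'.2.2.1 + t'.2.1 + t'.2.2.2 ∨
      t.2.2.1 + t.2.1 + t.2.2.2 = t'.2.2.1 + t'.2.1 + t'.2.2.2 ∧
        (t.2.2.1 + t.2.1 < t'.2.2.1 + t'.2.1 ∨
          t.2.2.1 + t.2.1 = t'.2.2.1 + t'.2.1 ∧ t.2.1 < t'.2.1)) ∨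
  0 ≤ t.2.1 ∧ 0 ≤ t'.2.1 ∧ 0 ≤ t.2.2.2 ∧ 0 ≤ t'.2.2.2 ∧
    (t.2.1 + t.2.2.2 < t'.2.1 + t'.2.2.2 ∨
      t.2.1 + t.2.2.2 = t'.2.1 + t'.2.2.2 ∧
        (t.2.2.1 + t.2.1 < t'.2.2.1 + t'.2.1 ∨
          t.2.2.1 + t.2.1 = t'.2.2.1 + t'.2.1 ∧ t.2.1 < t'.2.1))

set_option maxHeartbeats 4000000 in
theorem rowExp_add_rowExp_eq_zero {n : ℕ} {a r b s a' r' b' s' : ℤ}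
    (h : IsAdmissible n (a, r, b, s)) (h' : IsAdmissible n (a', r', b', s'))
    (hA : OrderA (a, r, b, s) (a', r', b', s')) (hB : OrderB (a', r', b', s') (a, r, b, s)) :
    rowExp a r a' r' + rowExp b s b' s' = 0 := by
  obtain ⟨h1, h2, h3, h4, h5, h6, h7⟩ := h
  obtain ⟨h1', h2', h3', h4', h5', h6', h7'⟩ := h'
  simp only [OrderA, OrderB] at *
  rcases hA with hA | hA | hA
  · omega
  all_goals
    rcases hB with hB | hB | hB | hB | hB | hB
    all_goals first
      | omega
      | (unfold rowExp; split_ifs <;> omega)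

/-- The indices `(a, r, b, s)` of the dilogarithm arguments of the first factorization. -/
def indicesA (n : ℕ) : List (ℤ × ℤ × ℤ × ℤ) :=
  lexList n (fun k => n - k) (fun _ j => 2 * j + 2) (fun k j i =>
    (th n ((j : ℤ) + 1), ((k : ℤ) + 1) - th n ((j : ℤ) + 1) - 1,
      (j : ℤ) + 1, -((j : ℤ) + 1) + i)) ++
  lexList n (fun k => k + 1) (fun k j => 2 * (k + 1 - j)) fun k j i =>
    ((n : ℤ) - k + j, ((n : ℤ) - k + j) - th n ((k : ℤ) + 1),
      th n ((n : ℤ) - k + j), -(th n ((n : ℤ) - k + j)) + i)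

/-- The indices `(a, r, b, s)` of the dilogarithm arguments of the second factorization. -/
def indicesB (n : ℕ) : List (ℤ × ℤ × ℤ × ℤ) :=
  lexList n (fun k => k + 1) (fun k _ => n - k) (fun k j i =>
    (((n : ℤ) + 1 - k + j) - ((i : ℤ) + 1), ((i : ℤ) + 1) - th n (k : ℤ),
      ((i : ℤ) + 1) + th n ((n : ℤ) + 1 - k + j), -((i : ℤ) + 1))) ++
  lexList n (fun k => k + 1) (fun k _ => n - k) (fun k j i =>
    (((n : ℤ) + 1 - k + j) - ((i : ℤ) + 1), ((i : ℤ) + 1) - th n (k : ℤ),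
      ((i : ℤ) + 1) + th n ((n : ℤ) + 1 - k + j), th n ((n : ℤ) + 1 - k + j))) ++
  lexList n (fun k => n - k) (fun k _ => k + 1) (fun k j i =>
    (((i : ℤ) + 1) + th n ((k : ℤ) + 2 + j), (i : ℤ),
      ((k : ℤ) + 2 + j) - ((i : ℤ) + 1), ((k : ℤ) + 1) - ((k : ℤ) + 2 + j))) ++
  lexList n (fun k => n - k) (fun k _ => k + 1) fun k j i =>
    (((i : ℤ) + 1) + th n ((k : ℤ) + 2 + j), (i : ℤ),
      ((k : ℤ) + 2 + j) - ((i : ℤ) + 1), ((k : ℤ) + 1) - ((i : ℤ) + 1))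

theorem flatMap_coe_list {β : Type*} (L : List ℕ) (f : ℤ → List β) :
    List.flatMap f (do let a ← L; pure (a : ℤ)) = L.flatMap fun k : ℕ => f k := by
  induction L with
  | nil => rfl
  | cons x L ih => simpa using ih

theorem argsA_eq (n : ℕ) : argsA n = (indicesA n).map (dilogArg n) := by
  simp only [argsA, indicesA, lexList, List.map_append, List.map_flatMap, List.map_map,
    map_coe_list, Function.comp_def, dilogArg]

theorem argsB_eq (n : ℕ) : argsB n = (indicesB n).map (dilogArg n) := by
  simp only [argsB, indicesB, lexList, List.map_append, List.map_flatMap, List.map_map,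
    map_coe_list, flatMap_coe_list, Function.comp_def, dilogArg]

theorem mem_indicesA {n : ℕ} {t : ℤ × ℤ × ℤ × ℤ} : t ∈ indicesA n ↔ IsAdmissible n t := by
  obtain ⟨a, r, b, s⟩ := t
  simp only [indicesA, List.mem_append, mem_lexList, Prod.mk.injEq, th]
  constructor
  · rintro (⟨k, hk, j, hj, i, hi, h⟩ | ⟨k, hk, j, hj, i, hi, h⟩) <;> constructor <;>
      dsimp only <;> omega
  · rintro ⟨h1, h2, h3, h4, h5, h6, h7⟩
    dsimp only at *
    rcases lt_or_ge r 0 with hr | hr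
    · refine Or.inl ⟨(r + a).toNat, ?_, (b - 1).toNat, ?_, (s + b).toNat, ?_, ?_⟩ <;> omega
    · refine Or.inr ⟨(n + r - a).toNat, ?_, r.toNat, ?_, (s + b).toNat, ?_, ?_⟩ <;> omega

theorem mem_indicesB {n : ℕ} {t : ℤ × ℤ × ℤ × ℤ} : t ∈ indicesB n ↔ IsAdmissible n t := by
  obtain ⟨a, r, b, s⟩ := t
  simp only [indicesB, List.mem_append, mem_lexList, Prod.mk.injEq, th]
  constructor
  · rintro (((⟨k, hk, j, hj, i, hi, h⟩ | ⟨k, hk, j, hj, i, hi, h⟩) |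
      ⟨k, hk, j, hj, i, hi, h⟩) | ⟨k, hk, j, hj, i, hi, h⟩) <;> constructor <;>
      dsimp only <;> omega
  · rintro ⟨h1, h2, h3, h4, h5, h6, h7⟩
    dsimp only at *
    rcases lt_or_ge r 0 with hr | hr <;> rcases lt_or_ge s 0 with hs | hs
    · refine Or.inl <| Or.inl <| Or.inl
        ⟨(n + 1 + s + r).toNat, ?_, (a + r).toNat, ?_, (-s - 1).toNat, ?_, ?_⟩ <;> omega
    · refine Or.inl <| Or.inl <| Or.inr
        ⟨(a + r + s).toNat, ?_, (a + r).toNat, ?_, (b - s - 1).toNat, ?_, ?_⟩ <;> omega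
    · refine Or.inl <| Or.inr
        ⟨(b + r + s).toNat, ?_, (-s - 1).toNat, ?_, r.toNat, ?_, ?_⟩ <;> omega
    · refine Or.inr ⟨(r + s).toNat, ?_, (b - s - 1).toNat, ?_, r.toNat, ?_, ?_⟩ <;> omega

theorem pairwise_indicesA (n : ℕ) : (indicesA n).Pairwise OrderA := by
  refine List.pairwise_append.2 ⟨?_, ?_, ?_⟩
  · refine pairwise_lexList ?_ ?_ ?_ <;> intros <;> right <;> left <;>
      simp only [th, true_and] <;> omega
  · refine pairwise_lexList ?_ ?_ ?_ <;> intros <;> right <;> right <;>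
      simp only [th, true_and] <;> omega
  · simp only [mem_lexList, th]
    rintro _ ⟨k, hk, j, hj, i, hi, rfl⟩ _ ⟨k', hk', j', hj', i', hi', rfl⟩
    left
    dsimp only
    omega

theorem pairwise_indicesB (n : ℕ) : (indicesB n).Pairwise OrderB := by
  refine List.pairwise_append.2 ⟨List.pairwise_append.2 ⟨List.pairwise_append.2 ⟨?_, ?_, ?_⟩,
    ?_, ?_⟩, ?_, ?_⟩
  · refine pairwise_lexList ?_ ?_ ?_ <;> intros <;> (iterate 2 right) <;> left <;>
      simp only [th] <;> omega
  · refine pairwise_lexList ?_ ?_ ?_ <;> intros <;> (iterate 3 right) <;> left <;>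
      simp only [th, true_and] <;> omega
  · simp only [mem_lexList, th]
    rintro _ ⟨k, hk, j, hj, i, hi, rfl⟩ _ ⟨k', hk', j', hj', i', hi', rfl⟩
    right; left
    dsimp only
    omega
  · refine pairwise_lexList ?_ ?_ ?_ <;> intros <;> (iterate 4 right) <;> left <;>
      dsimp only [th] <;> omega
  · simp only [List.mem_append, mem_lexList, th]
    rintro _ (⟨k, hk, j, hj, i, hi, rfl⟩ | ⟨k, hk, j, hj, i, hi, rfl⟩)
      _ ⟨k', hk', j', hj', i', hi', rfl⟩ <;> left <;> dsimp only <;> omega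
  · refine pairwise_lexList ?_ ?_ ?_ <;> intros <;> (iterate 5 right) <;>
      dsimp only [th] <;> omega
  · simp only [List.mem_append, mem_lexList, th]
    rintro _ ((⟨k, hk, j, hj, i, hi, rfl⟩ | ⟨k, hk, j, hj, i, hi, rfl⟩) |
      ⟨k, hk, j, hj, i, hi, rfl⟩) _ ⟨k', hk', j', hj', i', hi', rfl⟩
    · left; dsimp only; omega
    · left; dsimp only; omega
    · right; left; dsimp only; omega

theorem indicesA_perm_indicesB (n : ℕ) : (indicesA n).Perm (indicesB n) := by
  refine (List.perm_ext_iff_of_nodup ?_ ?_).2 fun t => mem_indicesA.trans mem_indicesB.symm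
  · refine (pairwise_indicesA n).imp fun {t t'} h => ?_
    rintro rfl
    simp only [OrderA] at h
    omega
  · refine (pairwise_indicesB n).imp fun {t t'} h => ?_
    rintro rfl
    simp only [OrderB] at h
    omega

theorem commute_of_orderA_of_orderB {n : ℕ} {t t' : ℤ × ℤ × ℤ × ℤ} (h : IsAdmissible n t)
    (h' : IsAdmissible n t') (hA : OrderA t t') (hB : OrderB t' t) :
    Commute (dilogArg n t) (dilogArg n t') :=
  commute_dilogArg h h' (rowExp_add_rowExp_eq_zero h h' hA hB)

/-- The two quantum dilogarithm factorizations of the flipped quasi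
`R`-matrix coincide in `(𝒟ₙ ⊗ 𝒟ₙ)⟦t⟧`; moreover, any two dilogarithm arguments that
occur in opposite relative order in the two products commute with each other. -/
theorem statement14 (n : ℕ) (hn : 1 ≤ n) :
    (((argsA n).map fun x => psiH 1 x).prod = ((argsB n).map fun x => psiH 1 x).prod) ∧
    (∀ p q p' q' : ℕ, p < q → q < (argsB n).length → p' < q' → q' < (argsA n).length →
      (argsB n).getD p 0 = (argsA n).getD q' 0 → (argsB n).getD q 0 = (argsA n).getD p' 0 →
      Commute ((argsB n).getD p 0) ((argsB n).getD q 0)) := by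
  rw [argsA_eq, argsB_eq]
  refine ⟨?_, fun p q p' q' hpq hq hpq' hq' hp hp' => ?_⟩
  · rw [List.map_map, List.map_map]
    exact prod_map_eq_of_perm _ (indicesA_perm_indicesB n) (pairwise_indicesA n)
      (pairwise_indicesB n) fun t ht t' ht' hA hB => commute_psiH
        (commute_of_orderA_of_orderB (mem_indicesA.1 ht) (mem_indicesA.1 ht') hA hB)
  · rcases subsingleton_or_nontrivial (AA n) with _ | _
    · exact Subsingleton.elim _ _
    rw [List.length_map] at hq hq'
    have hB (i : ℕ) (hi : i < (indicesB n).length) :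
        ((indicesB n).map (dilogArg n)).getD i 0 = dilogArg n (indicesB n)[i] := by
      rw [List.getD_eq_getElem _ _ (by simpa using hi), List.getElem_map]
    have hA (i : ℕ) (hi : i < (indicesA n).length) :
        ((indicesA n).map (dilogArg n)).getD i 0 = dilogArg n (indicesA n)[i] := by
      rw [List.getD_eq_getElem _ _ (by simpa using hi), List.getElem_map]
    have admB (i : ℕ) (hi : i < (indicesB n).length) := mem_indicesB.1 (List.getElem_mem hi)
    have admA (i : ℕ) (hi : i < (indicesA n).length) := mem_indicesA.1 (List.getElem_mem hi)
    rw [hB p (hpq.trans hq), hA q' hq'] at hp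
    rw [hB q hq, hA p' (hpq'.trans hq')] at hp'
    rw [hB p (hpq.trans hq), hB q hq]
    have e := dilogArg_injective (admB _ _) (admA _ _) hp
    have e' := dilogArg_injective (admB _ _) (admA _ _) hp'
    have ordA := List.pairwise_iff_getElem.1 (pairwise_indicesA n) p' q' (hpq'.trans hq') hq' hpq'
    rw [← e, ← e'] at ordA
    exact (commute_of_orderA_of_orderB (admB _ _) (admB _ _) ordA
      (List.pairwise_iff_getElem.1 (pairwise_indicesB n) p q _ hq hpq)).symm

end
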